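/- arXiv:2507.23316 — 2 statements merged into one kernel-verified Lean document; each statement's English description precedes it below -/
import Mathlib

section
/- For a lower semilinear diagonal δ ∈ 𝒟^LSL, the identity τ(δ) = φ(δ) holds if and only if δ = u_a for some a ∈ [0,1]. -/
open MeasureTheory Set

/-- A lower semilinear diagonal: nondecreasing, 2-Lipschitz on `[0,1]`, `δ 1 = 1`,
`t² ≤ δ t ≤ t` on `[0,1]`, `t ↦ δ t / t` nondecreasing on `(0,1]` and
`t ↦ δ t / t²` nonincreasing on `(0,1]`. -/
def IsLSL (δ : ℝ → ℝ) : Prop :=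
  MonotoneOn δ (Icc 0 1) ∧
  LipschitzOnWith 2 δ (Icc 0 1) ∧
  δ 1 = 1 ∧
  (∀ t ∈ Icc (0:ℝ) 1, t ^ 2 ≤ δ t ∧ δ t ≤ t) ∧
  MonotoneOn (fun t => δ t / t) (Ioc 0 1) ∧
  AntitoneOn (fun t => δ t / t ^ 2) (Ioc 0 1)

/-- Kendall's tau of the lower semilinear copula with diagonal `δ`. -/
noncomputable def tauLSL (δ : ℝ → ℝ) : ℝ := 4 * (∫ t in (0:ℝ)..1, (δ t) ^ 2 / t) - 1

/-- Spearman's rho of the lower semilinear copula with diagonal `δ`. -/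
noncomputable def rhoLSL (δ : ℝ → ℝ) : ℝ := 12 * (∫ t in (0:ℝ)..1, t * δ t) - 3

/-- Spearman's footrule of the lower semilinear copula with diagonal `δ`. -/
noncomputable def phiLSL (δ : ℝ → ℝ) : ℝ := 6 * (∫ t in (0:ℝ)..1, δ t) - 2

/-- Chatterjee's rank correlation of the lower semilinear copula with diagonal `δ`,
expressed through the a.e. derivative of `δ` (represented by `deriv δ`, which agrees
with the a.e. derivative almost everywhere since `δ` is Lipschitz on `[0,1]`). -/
noncomputable def xiLSL (δ : ℝ → ℝ) : ℝ :=
  tauLSL δ - 2 * ∫ t in (0:ℝ)..1,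
    (t * deriv δ t - δ t) * (2 * δ t - t * deriv δ t) / t

/-- The diagonal `u_a`: `u_a t = t²/a` for `t ≤ a`, `u_a t = t` otherwise (`u_0 t = t`). -/
noncomputable def uDiag (a : ℝ) (t : ℝ) : ℝ :=
  if a = 0 then t else if t ≤ a then t ^ 2 / a else t

/-- The diagonal `l_a`: `l_a t = a·t` for `t ≤ a`, `l_a t = t²` otherwise. -/
noncomputable def lDiag (a : ℝ) (t : ℝ) : ℝ := if t ≤ a then a * t else t ^ 2

namespace IsLSL

variable {δ : ℝ → ℝ}

lemma absolutelyContinuousOnInterval (hδ : IsLSL δ) {a b : ℝ} (ha : a ∈ Icc (0 : ℝ) 1)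
    (hb : b ∈ Icc (0 : ℝ) 1) : AbsolutelyContinuousOnInterval δ a b :=
  (hδ.2.1.mono (uIcc_subset_Icc ha hb)).absolutelyContinuousOnInterval

lemma intervalIntegrable_sq_div (hδ : IsLSL δ) :
    IntervalIntegrable (fun t => δ t ^ 2 / t) volume 0 1 := by
  rw [intervalIntegrable_iff_integrableOn_Ioc_of_le zero_le_one]
  refine ⟨?_, .restrict_of_bounded (C := 1) (by simp) ?_⟩
  · have hc : ContinuousOn δ (Ioc 0 1) := hδ.2.1.continuousOn.mono Ioc_subset_Icc_self
    have hc' : ContinuousOn (fun t => δ t ^ 2 / t) (Ioc 0 1) :=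
      (hc.pow 2).div continuousOn_id fun t ht => ht.1.ne'
    exact hc'.aestronglyMeasurable measurableSet_Ioc
  · refine (ae_restrict_iff' measurableSet_Ioc).2 (Filter.Eventually.of_forall fun t ht => ?_)
    obtain ⟨h₁, h₂⟩ := hδ.2.2.2.1 t (Ioc_subset_Icc_self ht)
    have h₀ : 0 ≤ δ t := (sq_nonneg t).trans h₁
    rw [Real.norm_of_nonneg (div_nonneg (sq_nonneg _) ht.1.le), div_le_one ht.1]
    nlinarith [ht.1, ht.2]

lemma deriv_le (hδ : IsLSL δ) {t : ℝ} (ht : t ∈ Ioo (0 : ℝ) 1) (hd : DifferentiableAt ℝ δ t) :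
    deriv δ t ≤ 2 * δ t / t := by
  have hq : HasDerivAt (fun t => δ t / t ^ 2)
      ((deriv δ t * t ^ 2 - δ t * (2 * t)) / (t ^ 2) ^ 2) t := by
    simpa using hd.hasDerivAt.fun_div (hasDerivAt_pow 2 t) (pow_ne_zero 2 ht.1.ne')
  have hle : derivWithin (fun t => δ t / t ^ 2) (Ioc 0 1) t ≤ 0 :=
    hδ.2.2.2.2.2.derivWithin_nonpos
  rw [derivWithin_of_mem_nhds (Ioc_mem_nhds ht.1 ht.2), hq.deriv] at hle
  have hpos : (0 : ℝ) < (t ^ 2) ^ 2 := pow_pos (pow_pos ht.1 2) 2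
  rw [div_le_iff₀ hpos, zero_mul] at hle
  rw [le_div_iff₀ ht.1]
  have : t * (deriv δ t * t - 2 * δ t) ≤ t * 0 := by linarith
  linarith [le_of_mul_le_mul_left this ht.1]

lemma intervalIntegrable_gap_expanded (hδ : IsLSL δ) :
    IntervalIntegrable (fun t => (2 * δ t - 2 * (δ t ^ 2 / t)) - (t * deriv δ t - δ t * deriv δ t))
      volume 0 1 := by
  have hac := hδ.absolutelyContinuousOnInterval (left_mem_Icc.2 zero_le_one)
    (right_mem_Icc.2 zero_le_one)
  have hd := hac.intervalIntegrable_deriv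
  exact ((hac.continuousOn.intervalIntegrable.const_mul 2).sub
    (hδ.intervalIntegrable_sq_div.const_mul 2)).sub
    ((hd.continuousOn_mul continuousOn_id).sub (hd.continuousOn_mul hac.continuousOn))

lemma gap_eq {t : ℝ} (ht : t ≠ 0) :
    (2 * δ t / t - deriv δ t) * (t - δ t) =
      (2 * δ t - 2 * (δ t ^ 2 / t)) - (t * deriv δ t - δ t * deriv δ t) := by
  field_simp

lemma intervalIntegrable_gap (hδ : IsLSL δ) :
    IntervalIntegrable (fun t => (2 * δ t / t - deriv δ t) * (t - δ t)) volume 0 1 := by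
  refine hδ.intervalIntegrable_gap_expanded.congr fun t ht => ?_
  rw [uIoc_of_le zero_le_one] at ht
  exact (gap_eq ht.1.ne').symm

lemma phiLSL_sub_tauLSL (hδ : IsLSL δ) :
    phiLSL δ - tauLSL δ = 2 * ∫ t in (0:ℝ)..1, (2 * δ t / t - deriv δ t) * (t - δ t) := by
  have hac := hδ.absolutelyContinuousOnInterval (left_mem_Icc.2 zero_le_one)
    (right_mem_Icc.2 zero_le_one)
  have hid : AbsolutelyContinuousOnInterval (fun t : ℝ => t) 0 1 :=
    (LipschitzWith.id.lipschitzOnWith).absolutelyContinuousOnInterval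
  have hd := hac.intervalIntegrable_deriv
  have h₀ : δ 0 = 0 := by
    have := hδ.2.2.2.1 0 (left_mem_Icc.2 zero_le_one)
    norm_num at this
    linarith
  have h₁ : δ 1 = 1 := hδ.2.2.1
  have hI₁ : ∫ t in (0:ℝ)..1, t * deriv δ t = 1 - ∫ t in (0:ℝ)..1, δ t := by
    simpa [h₀, h₁] using hid.integral_mul_deriv_eq_deriv_mul hac
  have hI₂ : ∫ t in (0:ℝ)..1, δ t * deriv δ t = 1 / 2 := by
    have h := hac.integral_mul_deriv_eq_deriv_mul hac
    have h' : ∫ t in (0:ℝ)..1, deriv δ t * δ t = ∫ t in (0:ℝ)..1, δ t * deriv δ t := by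
      simp_rw [mul_comm]
    rw [h', h₀, h₁] at h
    linarith
  have hI : ∫ t in (0:ℝ)..1, (2 * δ t / t - deriv δ t) * (t - δ t) =
      ∫ t in (0:ℝ)..1, ((2 * δ t - 2 * (δ t ^ 2 / t)) - (t * deriv δ t - δ t * deriv δ t)) := by
    refine intervalIntegral.integral_congr_ae (Filter.Eventually.of_forall fun t ht => ?_)
    rw [uIoc_of_le zero_le_one] at ht
    exact gap_eq ht.1.ne'
  have hi₁ := hac.continuousOn.intervalIntegrable.const_mul 2 (μ := volume)
  have hi₂ := hδ.intervalIntegrable_sq_div.const_mul 2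
  have hi₃ : IntervalIntegrable (fun t => t * deriv δ t) volume 0 1 :=
    hd.continuousOn_mul continuousOn_id
  have hi₄ := hd.continuousOn_mul hac.continuousOn
  rw [hI, intervalIntegral.integral_sub (hi₁.sub hi₂) (hi₃.sub hi₄),
    intervalIntegral.integral_sub hi₁ hi₂, intervalIntegral.integral_sub hi₃ hi₄,
    intervalIntegral.integral_const_mul, intervalIntegral.integral_const_mul, hI₁, hI₂, phiLSL,
    tauLSL]
  ring

lemma ae_gap_nonneg (hδ : IsLSL δ) :
    0 ≤ᵐ[volume.restrict (Ioc 0 1)] fun t => (2 * δ t / t - deriv δ t) * (t - δ t) := by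
  have hac := hδ.absolutelyContinuousOnInterval (left_mem_Icc.2 zero_le_one)
    (right_mem_Icc.2 zero_le_one)
  refine (ae_restrict_iff' measurableSet_Ioc).2 ?_
  filter_upwards [hac.ae_differentiableAt, Measure.ae_ne volume (1 : ℝ)] with t hd h1 ht
  have ht' : t ∈ Icc (0 : ℝ) 1 := Ioc_subset_Icc_self ht
  rw [uIcc_of_le zero_le_one] at hd
  exact mul_nonneg (sub_nonneg.2 (hδ.deriv_le ⟨ht.1, lt_of_le_of_ne ht.2 h1⟩ (hd ht')))
    (sub_nonneg.2 (hδ.2.2.2.1 t ht').2)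

lemma tauLSL_eq_phiLSL_iff_ae (hδ : IsLSL δ) :
    tauLSL δ = phiLSL δ ↔
      ∀ᵐ t, t ∈ Ioc (0 : ℝ) 1 → (2 * δ t / t - deriv δ t) * (t - δ t) = 0 := by
  rw [← ae_restrict_iff' measurableSet_Ioc]
  have h := intervalIntegral.integral_eq_zero_iff_of_le_of_nonneg_ae zero_le_one hδ.ae_gap_nonneg
    hδ.intervalIntegrable_gap
  refine Iff.trans ?_ h
  have := hδ.phiLSL_sub_tauLSL
  constructor <;> intro <;> linarith

/-- If `t δ'(t) = 2 δ(t)` almost everywhere on `[s, a]`, then `δ(t) / t²` is constant there. -/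
lemma div_sq_eq_of_ae_deriv (hδ : IsLSL δ) {s a : ℝ} (hs : 0 < s) (hsa : s ≤ a) (ha : a ≤ 1)
    (h : ∀ᵐ t, t ∈ Ioc s a → t * deriv δ t = 2 * δ t) : δ s / s ^ 2 = δ a / a ^ 2 := by
  have ha₀ : 0 < a := hs.trans_le hsa
  have hq := hδ.2.2.2.2.2
  refine le_antisymm ?_ (hq ⟨hs, hsa.trans ha⟩ ⟨ha₀, ha⟩ hsa)
  have hac := hδ.absolutelyContinuousOnInterval ⟨hs.le, hsa.trans ha⟩ ⟨ha₀.le, ha⟩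
  have hid : AbsolutelyContinuousOnInterval (fun t : ℝ => t) s a :=
    (LipschitzWith.id.lipschitzOnWith).absolutelyContinuousOnInterval
  have hI : ∫ t in s..a, t * deriv δ t = a * δ a - s * δ s - ∫ t in s..a, δ t := by
    simpa using hid.integral_mul_deriv_eq_deriv_mul hac
  have hI' : ∫ t in s..a, t * deriv δ t = 2 * ∫ t in s..a, δ t := by
    rw [← intervalIntegral.integral_const_mul]
    refine intervalIntegral.integral_congr_ae ?_
    rwa [uIoc_of_le hsa]
  have hle : ∫ t in s..a, δ a / a ^ 2 * t ^ 2 ≤ ∫ t in s..a, δ t := by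
    refine intervalIntegral.integral_mono_on hsa (Continuous.intervalIntegrable (by fun_prop) _ _)
      hac.continuousOn.intervalIntegrable fun t ht => ?_
    have ht₀ : 0 < t := hs.trans_le ht.1
    exact (le_div_iff₀ (pow_pos ht₀ 2)).1 (hq ⟨ht₀, ht.2.trans ha⟩ ⟨ha₀, ha⟩ ht.2)
  rw [intervalIntegral.integral_const_mul, integral_pow] at hle
  norm_num at hle
  rw [div_le_iff₀ (pow_pos hs 2)]
  refine le_of_mul_le_mul_left ?_ hs
  have hda : a * δ a = δ a / a ^ 2 * a ^ 3 := by field_simp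
  nlinarith

lemma exists_eq_uDiag_of_tauLSL_eq_phiLSL (hδ : IsLSL δ) (h : tauLSL δ = phiLSL δ) :
    ∃ a ∈ Icc (0 : ℝ) 1, ∀ t ∈ Icc (0 : ℝ) 1, δ t = uDiag a t := by
  rw [hδ.tauLSL_eq_phiLSL_iff_ae] at h
  have hbd := hδ.2.2.2.1
  have h₀ : δ 0 = 0 := by
    have := hbd 0 (left_mem_Icc.2 zero_le_one)
    norm_num at this
    linarith
  set S : Set ℝ := {t ∈ Ioc (0 : ℝ) 1 | δ t = t} with hS
  have h1S : (1 : ℝ) ∈ S := ⟨right_mem_Ioc.2 zero_lt_one, hδ.2.2.1⟩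
  have hbelow : BddBelow S := ⟨0, fun t ht => ht.1.1.le⟩
  have ha₀ : 0 ≤ sInf S := le_csInf ⟨1, h1S⟩ fun t ht => ht.1.1.le
  have ha₁ : sInf S ≤ 1 := csInf_le hbelow h1S
  have hgt : ∀ t ∈ Ioc (0 : ℝ) 1, sInf S < t → δ t = t := by
    intro t ht hat
    obtain ⟨s, hs, hst⟩ := exists_lt_of_csInf_lt ⟨1, h1S⟩ hat
    have hm := hδ.2.2.2.2.1 hs.1 ht hst.le
    simp only [hs.2, div_self hs.1.1.ne'] at hm
    exact le_antisymm (hbd t (Ioc_subset_Icc_self ht)).2 (by simpa using (le_div_iff₀ ht.1).1 hm)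
  have hmem : δ (sInf S) = sInf S := by
    have hcl : IsClosed (Icc (0 : ℝ) 1 ∩ {t | δ t = t}) := by
      simpa [preimage, sub_eq_zero] using
        (hδ.2.1.continuousOn.sub continuousOn_id).preimage_isClosed_of_isClosed isClosed_Icc
          (isClosed_singleton (x := (0 : ℝ)))
    have hsub : S ⊆ Icc (0 : ℝ) 1 ∩ {t | δ t = t} := fun t ht => ⟨Ioc_subset_Icc_self ht.1, ht.2⟩
    exact (closure_minimal hsub hcl (csInf_mem_closure ⟨1, h1S⟩ hbelow)).2
  refine ⟨sInf S, ⟨ha₀, ha₁⟩, fun t ht => ?_⟩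
  unfold uDiag
  rcases ht.1.eq_or_lt with rfl | ht₀
  · simp [h₀]
  split_ifs with ha hta
  · exact hgt t ⟨ht₀, ht.2⟩ (ha ▸ ht₀)
  · have hae : ∀ᵐ x, x ∈ Ioc t (sInf S) → x * deriv δ x = 2 * δ x := by
      filter_upwards [h, Measure.ae_ne volume (sInf S)] with x hx hxa hxt
      have hx₀ : 0 < x := ht₀.trans hxt.1
      have hx' : x ∈ Ioc (0 : ℝ) 1 := ⟨hx₀, hxt.2.trans ha₁⟩
      have hne : x - δ x ≠ 0 := fun h0 =>
        hxa (le_antisymm hxt.2 (csInf_le hbelow ⟨hx', by linarith⟩))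
      have := (mul_eq_zero.1 (hx hx')).resolve_right hne
      field_simp at this
      linarith
    have hq := hδ.div_sq_eq_of_ae_deriv ht₀ hta ha₁ hae
    rw [hmem] at hq
    field_simp at hq ⊢
    linarith
  · exact hgt t ⟨ht₀, ht.2⟩ (not_le.1 hta)

lemma tauLSL_eq_phiLSL_of_eq_uDiag (hδ : IsLSL δ) {a : ℝ}
    (h : ∀ t ∈ Icc (0 : ℝ) 1, δ t = uDiag a t) : tauLSL δ = phiLSL δ := by
  rw [hδ.tauLSL_eq_phiLSL_iff_ae]
  filter_upwards [Measure.ae_ne volume a, Measure.ae_ne volume (1 : ℝ)] with t hta ht1 ht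
  have hδt := h t (Ioc_subset_Icc_self ht)
  unfold uDiag at hδt
  split_ifs at hδt with ha hle
  · simp [hδt]
  · have hlt : t < min a 1 := lt_min (lt_of_le_of_ne hle hta) (lt_of_le_of_ne ht.2 ht1)
    have hev : δ =ᶠ[nhds t] fun t => t ^ 2 / a := by
      filter_upwards [Ioo_mem_nhds ht.1 hlt] with x hx
      have hxa : x ≤ a := hx.2.le.trans (min_le_left _ _)
      rw [h x ⟨hx.1.le, hx.2.le.trans (min_le_right _ _)⟩, uDiag, if_neg ha, if_pos hxa]
    have hd : deriv δ t = 2 * t / a := by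
      rw [hev.deriv_eq]
      simp
    have ht₀ := ht.1.ne'
    rw [hd, hδt]
    field_simp
    ring
  · simp [hδt]

end IsLSL

/-- Within lower semilinear diagonals, `τ(δ) = φ(δ)` holds iff `δ = u_a` for some `a ∈ [0,1]`. -/
theorem tau_eq_phi_iff (δ : ℝ → ℝ) (hδ : IsLSL δ) :
    tauLSL δ = phiLSL δ ↔
    ∃ a ∈ Icc (0:ℝ) 1, ∀ t ∈ Icc (0:ℝ) 1, δ t = uDiag a t := by
  constructor
  · exact hδ.exists_eq_uDiag_of_tauLSL_eq_phiLSL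
  · rintro ⟨a, -, h⟩
    exact hδ.tauLSL_eq_phiLSL_of_eq_uDiag h
end

section
/- The τ-φ region for lower semilinear copulas, i.e., the set { (τ(δ), φ(δ)) : δ ∈ 𝒟^LSL } ⊆ ℝ², is convex and compact. -/
open MeasureTheory Set

/-- Monotonicity and the Lipschitz bound follow from the other conditions. -/
theorem IsLSL.mk_of_ratio {δ : ℝ → ℝ} (h1 : δ 1 = 1)
    (hb : ∀ t ∈ Icc (0:ℝ) 1, t ^ 2 ≤ δ t ∧ δ t ≤ t)
    (hm : MonotoneOn (fun t => δ t / t) (Ioc 0 1))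
    (ha : AntitoneOn (fun t => δ t / t ^ 2) (Ioc 0 1)) : IsLSL δ := by
  have h0 : δ 0 = 0 := by
    have := hb 0 (by simp)
    norm_num at this
    linarith
  have mono : MonotoneOn δ (Icc 0 1) := by
    intro s hs t ht hst
    rcases eq_or_lt_of_le hs.1 with rfl | hs0
    · rw [h0]
      nlinarith [(hb t ht).1]
    · have ht0 : 0 < t := hs0.trans_le hst
      have h := hm ⟨hs0, hs.2⟩ ⟨ht0, ht.2⟩ hst
      simp only at h
      rw [div_le_div_iff₀ hs0 ht0] at h
      have : 0 ≤ δ t := by nlinarith [(hb t ht).1]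
      nlinarith
  have key : ∀ s ∈ Icc (0:ℝ) 1, ∀ t ∈ Icc (0:ℝ) 1, s ≤ t → δ t - δ s ≤ 2 * (t - s) := by
    intro s hs t ht hst
    rcases eq_or_lt_of_le hs.1 with rfl | hs0
    · rw [h0]
      linarith [(hb t ht).2, ht.1]
    · have ht0 : 0 < t := hs0.trans_le hst
      have h := ha ⟨hs0, hs.2⟩ ⟨ht0, ht.2⟩ hst
      simp only at h
      rw [div_le_div_iff₀ (by positivity) (by positivity)] at h
      have h2 : δ t * (t ^ 2 - s ^ 2) ≤ t * (t ^ 2 - s ^ 2) :=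
        mul_le_mul_of_nonneg_right (hb t ht).2 (by nlinarith)
      have h3 : t * (t ^ 2 - s ^ 2) ≤ t ^ 2 * (2 * (t - s)) := by
        nlinarith [mul_nonneg ht0.le (mul_nonneg (sub_nonneg.2 hst) (sub_nonneg.2 hst))]
      have h4 : t ^ 2 * (δ t - δ s) ≤ t ^ 2 * (2 * (t - s)) := by nlinarith
      exact le_of_mul_le_mul_left h4 (by positivity)
  refine ⟨mono, ?_, h1, hb, hm, ha⟩
  refine LipschitzOnWith.of_dist_le_mul fun s hs t ht => ?_
  rw [Real.dist_eq, Real.dist_eq]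
  simp only [NNReal.coe_ofNat]
  rcases le_total s t with hst | hst
  · rw [abs_of_nonpos (by linarith [mono hs ht hst]), abs_of_nonpos (by linarith)]
    linarith [key s hs t ht hst]
  · rw [abs_of_nonneg (by linarith [mono ht hs hst]), abs_of_nonneg (by linarith)]
    linarith [key t ht s hs hst]

theorem IsLSL.convex_combination {δ ε : ℝ → ℝ} (hδ : IsLSL δ) (hε : IsLSL ε) {a b : ℝ}
    (ha : 0 ≤ a) (hb : 0 ≤ b) (hab : a + b = 1) : IsLSL (fun t => a * δ t + b * ε t) := by
  obtain ⟨-, -, d1, db, dm, da⟩ := hδ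
  obtain ⟨-, -, e1, eb, em, ea⟩ := hε
  refine IsLSL.mk_of_ratio (by simp [d1, e1, hab]) (fun t ht => ?_) ?_ ?_
  · have h1 := mul_le_mul_of_nonneg_left (db t ht).1 ha
    have h2 := mul_le_mul_of_nonneg_left (db t ht).2 ha
    have h3 := mul_le_mul_of_nonneg_left (eb t ht).1 hb
    have h4 := mul_le_mul_of_nonneg_left (eb t ht).2 hb
    obtain rfl : b = 1 - a := by linarith
    constructor <;> linarith
  · intro s hs t ht hst
    have h1 := mul_le_mul_of_nonneg_left (dm hs ht hst) ha
    have h2 := mul_le_mul_of_nonneg_left (em hs ht hst) hb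
    simp only [add_div, mul_div_assoc] at *
    exact add_le_add h1 h2
  · intro s hs t ht hst
    have h1 := mul_le_mul_of_nonneg_left (da hs ht hst) ha
    have h2 := mul_le_mul_of_nonneg_left (ea hs ht hst) hb
    simp only [add_div, mul_div_assoc] at *
    exact add_le_add h1 h2

theorem IsLSL.continuousOn {δ : ℝ → ℝ} (h : IsLSL δ) : ContinuousOn δ (Icc 0 1) :=
  h.2.1.continuousOn

theorem IsLSL.intervalIntegrable {δ : ℝ → ℝ} (h : IsLSL δ) :
    IntervalIntegrable δ volume 0 1 :=
  (h.continuousOn.mono (by simp)).intervalIntegrable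

theorem IsLSL.nonneg {δ : ℝ → ℝ} (h : IsLSL δ) {t : ℝ} (ht : t ∈ Icc (0:ℝ) 1) : 0 ≤ δ t :=
  (sq_nonneg t).trans (h.2.2.2.1 t ht).1

theorem IsLSL.aestronglyMeasurable_sq_div {δ : ℝ → ℝ} (h : IsLSL δ) :
    AEStronglyMeasurable (fun t => δ t ^ 2 / t) (volume.restrict (uIoc 0 1)) := by
  rw [uIoc_of_le zero_le_one]
  refine ContinuousOn.aestronglyMeasurable ?_ measurableSet_Ioc
  exact ((h.continuousOn.mono Ioc_subset_Icc_self).pow 2).div continuousOn_id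
    fun t ht => ht.1.ne'

theorem IsLSL.norm_sq_div_le {δ : ℝ → ℝ} (h : IsLSL δ) {t : ℝ} (ht : t ∈ uIoc (0:ℝ) 1) :
    ‖δ t ^ 2 / t‖ ≤ 1 := by
  rw [uIoc_of_le zero_le_one] at ht
  have h0 := h.nonneg (Ioc_subset_Icc_self ht)
  have h1 := (h.2.2.2.1 t (Ioc_subset_Icc_self ht)).2
  rw [Real.norm_of_nonneg (div_nonneg (sq_nonneg _) ht.1.le), div_le_one ht.1]
  nlinarith [ht.1, ht.2]

theorem IsLSL.intervalIntegrable_sq_div_s6 {δ : ℝ → ℝ} (h : IsLSL δ) :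
    IntervalIntegrable (fun t => δ t ^ 2 / t) volume 0 1 :=
  (intervalIntegrable_const (c := (1 : ℝ))).mono_fun' h.aestronglyMeasurable_sq_div
    ((ae_restrict_iff' measurableSet_uIoc).2 <| .of_forall fun _ ht => h.norm_sq_div_le ht)

theorem phiLSL_convex_combination {δ ε : ℝ → ℝ} (hδ : IsLSL δ) (hε : IsLSL ε) {a b : ℝ}
    (hab : a + b = 1) :
    phiLSL (fun t => a * δ t + b * ε t) = a * phiLSL δ + b * phiLSL ε := by
  unfold phiLSL
  rw [intervalIntegral.integral_add (hδ.intervalIntegrable.const_mul a)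
    (hε.intervalIntegrable.const_mul b), intervalIntegral.integral_const_mul,
    intervalIntegral.integral_const_mul]
  linear_combination 2 * hab

theorem tauLSL_convex_combination_le {δ ε : ℝ → ℝ} (hδ : IsLSL δ) (hε : IsLSL ε) {a b : ℝ}
    (ha : 0 ≤ a) (hb : 0 ≤ b) (hab : a + b = 1) :
    tauLSL (fun t => a * δ t + b * ε t) ≤ a * tauLSL δ + b * tauLSL ε := by
  have key : (∫ t in (0:ℝ)..1, (a * δ t + b * ε t) ^ 2 / t) ≤
      ∫ t in (0:ℝ)..1, (a * (δ t ^ 2 / t) + b * (ε t ^ 2 / t)) := by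
    refine intervalIntegral.integral_mono_on zero_le_one
      (hδ.convex_combination hε ha hb hab).intervalIntegrable_sq_div_s6
      ((hδ.intervalIntegrable_sq_div_s6.const_mul a).add
        (hε.intervalIntegrable_sq_div_s6.const_mul b)) fun t ht => ?_
    rw [← mul_div_assoc, ← mul_div_assoc, ← add_div]
    refine div_le_div_of_nonneg_right ?_ ht.1
    obtain rfl : b = 1 - a := by linarith
    nlinarith [mul_nonneg (mul_nonneg ha hb) (sq_nonneg (δ t - ε t))]
  rw [intervalIntegral.integral_add (hδ.intervalIntegrable_sq_div_s6.const_mul a)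
    (hε.intervalIntegrable_sq_div_s6.const_mul b), intervalIntegral.integral_const_mul,
    intervalIntegral.integral_const_mul] at key
  unfold tauLSL
  linarith

theorem IsLSL.mul_le_of_hasDerivAt {δ : ℝ → ℝ} (h : IsLSL δ) {t d : ℝ} (ht : t ∈ Ioo (0:ℝ) 1)
    (hd : HasDerivAt δ d t) : t * d ≤ 2 * δ t := by
  have ht0 : 0 < t := ht.1
  have h1 := hd.div (hasDerivAt_pow 2 t) (by positivity)
  have h2 : derivWithin (fun t => δ t / t ^ 2) (Ioc 0 1) t ≤ 0 := h.2.2.2.2.2.derivWithin_nonpos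
  rw [derivWithin_of_mem_nhds (Ioc_mem_nhds ht.1 ht.2)] at h2
  have h3 := h1.deriv
  simp only [Pi.div_def] at h3
  rw [h3, div_nonpos_iff] at h2
  have h4 : 0 < (t ^ 2) ^ 2 := by positivity
  have h5 : d * t ^ 2 - δ t * (2 * t) ≤ 0 := by
    rcases h2 with h2 | h2
    · linarith [h2.2]
    · simpa using h2.1
  have h6 : t * (t * d) ≤ t * (2 * δ t) := by linarith
  exact le_of_mul_le_mul_left h6 ht0

theorem IsLSL.tauLSL_le_phiLSL {δ : ℝ → ℝ} (h : IsLSL δ) : tauLSL δ ≤ phiLSL δ := by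
  have hac : AbsolutelyContinuousOnInterval δ 0 1 :=
    LipschitzOnWith.absolutelyContinuousOnInterval (K := 2) (by simpa using h.2.1)
  have hid : AbsolutelyContinuousOnInterval (fun t : ℝ => t) 0 1 :=
    LipschitzOnWith.absolutelyContinuousOnInterval (K := 1)
      (LipschitzWith.id.lipschitzOnWith)
  have hF : AbsolutelyContinuousOnInterval (fun t => t * δ t - (1 / 2) * (δ t * δ t)) 0 1 :=
    (hid.fun_mul hac).sub ((hac.fun_mul hac).const_mul _)
  have hint := hF.integral_deriv_eq_sub
  have key : (∫ t in (0:ℝ)..1, deriv (fun t => t * δ t - (1 / 2) * (δ t * δ t)) t) ≤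
      ∫ t in (0:ℝ)..1, (3 * δ t - 2 * (δ t ^ 2 / t)) := by
    refine intervalIntegral.integral_mono_ae_restrict zero_le_one hF.intervalIntegrable_deriv
      ((h.intervalIntegrable.const_mul 3).sub (h.intervalIntegrable_sq_div_s6.const_mul 2)) ?_
    rw [restrict_Ioo_eq_restrict_Icc.symm]
    refine (ae_restrict_iff' measurableSet_Ioo).2 ?_
    filter_upwards [hac.ae_differentiableAt] with t hdiff ht
    have hd := (hdiff (by simpa using Ioo_subset_Icc_self ht)).hasDerivAt
    have hle := h.mul_le_of_hasDerivAt ht hd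
    have hFd := ((hasDerivAt_id t).mul hd).sub ((hd.mul hd).const_mul (1 / 2))
    have heq := hFd.deriv
    simp only [Pi.mul_def, Pi.sub_def, id] at heq
    rw [heq]
    have ht0 : 0 < t := ht.1
    have hb := (h.2.2.2.1 t (Ioo_subset_Icc_self ht)).2
    have e : 3 * δ t - 2 * (δ t ^ 2 / t) = (3 * δ t * t - 2 * δ t ^ 2) / t := by
      field_simp
    rw [e, le_div_iff₀ ht0]
    nlinarith [mul_le_mul_of_nonneg_right hle (sub_nonneg.2 hb)]
  rw [hint, intervalIntegral.integral_sub (h.intervalIntegrable.const_mul 3)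
    (h.intervalIntegrable_sq_div_s6.const_mul 2), intervalIntegral.integral_const_mul,
    intervalIntegral.integral_const_mul, h.2.2.1] at key
  have h0 : 0 ≤ δ 0 ∧ δ 0 ≤ 0 := by simpa using h.2.2.2.1 0 (by simp)
  rw [le_antisymm h0.2 h0.1] at key
  unfold tauLSL phiLSL
  linarith

theorem IsLSL.phiLSL_mem_Icc {δ : ℝ → ℝ} (h : IsLSL δ) : phiLSL δ ∈ Icc (0:ℝ) 1 := by
  have h1 := intervalIntegral.integral_mono_on zero_le_one
    ((continuous_pow 2).intervalIntegrable 0 1) h.intervalIntegrable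
    fun t ht => (h.2.2.2.1 t ht).1
  have h2 := intervalIntegral.integral_mono_on zero_le_one h.intervalIntegrable
    (continuous_id.intervalIntegrable 0 1) fun t ht => (h.2.2.2.1 t ht).2
  simp only [id, integral_id, integral_pow] at h1 h2
  norm_num at h1 h2
  unfold phiLSL
  constructor <;> linarith

theorem isLSL_sq_div_max {a : ℝ} (ha : a ∈ Icc (0:ℝ) 1) :
    IsLSL (fun t => t ^ 2 / max a t) := by
  refine IsLSL.mk_of_ratio (by simp [ha.2]) (fun t ht => ?_) ?_ ?_
  · rcases eq_or_lt_of_le ht.1 with rfl | ht0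
    · simp
    · have hp : 0 < max a t := lt_max_of_lt_right ht0
      rw [le_div_iff₀ hp, div_le_iff₀ hp]
      have h1 : max a t ≤ 1 := max_le ha.2 ht.2
      have h2 : t ≤ max a t := le_max_right _ _
      constructor <;> nlinarith
  · intro s hs t ht hst
    have hs0 := hs.1
    have ht0 := ht.1
    have hps : 0 < max a s := lt_max_of_lt_right hs0
    have hpt : 0 < max a t := lt_max_of_lt_right ht0
    have e : ∀ r : ℝ, 0 < r → r ^ 2 / max a r / r = r / max a r := fun r hr => by
      have : 0 < max a r := lt_max_of_lt_right hr
      field_simp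
    simp only [e s hs0, e t ht0]
    rw [div_le_div_iff₀ hps hpt, mul_max_of_nonneg _ _ hs0.le, mul_max_of_nonneg _ _ ht0.le]
    have := mul_le_mul_of_nonneg_right hst ha.1
    exact max_le_max this (by linarith)
  · intro s hs t ht hst
    have hs0 := hs.1
    have ht0 := ht.1
    have hps : 0 < max a s := lt_max_of_lt_right hs0
    have e : ∀ r : ℝ, 0 < r → r ^ 2 / max a r / r ^ 2 = 1 / max a r := fun r hr => by
      have : 0 < max a r := lt_max_of_lt_right hr
      field_simp
    simp only [e s hs0, e t ht0]
    exact one_div_le_one_div_of_le hps (max_le_max_left a hst)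

theorem phiLSL_sq_div_max {a : ℝ} (ha : a ∈ Icc (0:ℝ) 1) :
    phiLSL (fun t => t ^ 2 / max a t) = 1 - a ^ 2 := by
  have hI := (isLSL_sq_div_max ha).intervalIntegrable
  have h1 : (∫ t in (0:ℝ)..a, t ^ 2 / max a t) = ∫ t in (0:ℝ)..a, t ^ 2 / a := by
    refine intervalIntegral.integral_congr fun t ht => ?_
    rw [uIcc_of_le ha.1] at ht
    simp [max_eq_left ht.2]
  have h2 : (∫ t in a..1, t ^ 2 / max a t) = ∫ t in a..1, t := by
    refine intervalIntegral.integral_congr fun t ht => ?_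
    rw [uIcc_of_le ha.2] at ht
    simp only [max_eq_right ht.1]
    rw [sq, mul_self_div_self]
  have hs := intervalIntegral.integral_add_adjacent_intervals
    (hI.mono_set (c := 0) (d := a) (uIcc_subset_uIcc_left (by simpa using ha)))
    (hI.mono_set (c := a) (d := 1) (uIcc_subset_uIcc_right (by simpa using ha)))
  rw [h1, h2, intervalIntegral.integral_div, integral_pow, integral_id] at hs
  unfold phiLSL
  rw [← hs]
  rcases eq_or_ne a 0 with rfl | h0
  · norm_num
  · norm_num
    field_simp
    ring

theorem tauLSL_sq_div_max {a : ℝ} (ha : a ∈ Icc (0:ℝ) 1) :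
    tauLSL (fun t => t ^ 2 / max a t) = 1 - a ^ 2 := by
  have hI := (isLSL_sq_div_max ha).intervalIntegrable_sq_div_s6
  have h1 : (∫ t in (0:ℝ)..a, (t ^ 2 / max a t) ^ 2 / t) = ∫ t in (0:ℝ)..a, t ^ 3 / a ^ 2 := by
    refine intervalIntegral.integral_congr fun t ht => ?_
    rw [uIcc_of_le ha.1] at ht
    simp only [max_eq_left ht.2]
    rcases eq_or_ne t 0 with rfl | h0
    · simp
    · field_simp
  have h2 : (∫ t in a..1, (t ^ 2 / max a t) ^ 2 / t) = ∫ t in a..1, t := by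
    refine intervalIntegral.integral_congr fun t ht => ?_
    rw [uIcc_of_le ha.2] at ht
    simp only [max_eq_right ht.1]
    rcases eq_or_ne t 0 with rfl | h0
    · simp
    · field_simp
  have hs := intervalIntegral.integral_add_adjacent_intervals
    (hI.mono_set (c := 0) (d := a) (uIcc_subset_uIcc_left (by simpa using ha)))
    (hI.mono_set (c := a) (d := 1) (uIcc_subset_uIcc_right (by simpa using ha)))
  rw [h1, h2, intervalIntegral.integral_div, integral_pow, integral_id] at hs
  unfold tauLSL
  rw [← hs]
  rcases eq_or_ne a 0 with rfl | h0
  · norm_num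
  · norm_num
    field_simp
    ring

theorem continuous_tauLSL {X : Type*} [TopologicalSpace X] [FirstCountableTopology X]
    {δ : X → ℝ → ℝ} (h : ∀ x, IsLSL (δ x)) (hc : ∀ t, Continuous fun x => δ x t) :
    Continuous fun x => tauLSL (δ x) := by
  unfold tauLSL
  refine (continuous_const.mul ?_).sub continuous_const
  exact intervalIntegral.continuous_of_dominated_interval
    (fun x => (h x).aestronglyMeasurable_sq_div)
    (fun x => .of_forall fun t ht => (h x).norm_sq_div_le ht)
    (intervalIntegrable_const (c := (1 : ℝ)))
    (.of_forall fun t _ => ((hc t).pow 2).div_const t)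

theorem continuous_phiLSL {X : Type*} [TopologicalSpace X] [FirstCountableTopology X]
    {δ : X → ℝ → ℝ} (h : ∀ x, IsLSL (δ x)) (hc : ∀ t, Continuous fun x => δ x t) :
    Continuous fun x => phiLSL (δ x) := by
  unfold phiLSL
  refine (continuous_const.mul ?_).sub continuous_const
  refine intervalIntegral.continuous_of_dominated_interval
    (fun x => ?_) (fun x => .of_forall fun t ht => ?_)
    (intervalIntegrable_const (c := (1 : ℝ))) (.of_forall fun t _ => hc t)
  · rw [uIoc_of_le zero_le_one]
    exact ((h x).continuousOn.mono Ioc_subset_Icc_self).aestronglyMeasurable measurableSet_Ioc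
  · rw [uIoc_of_le zero_le_one] at ht
    have ht' := Ioc_subset_Icc_self ht
    rw [Real.norm_of_nonneg ((h x).nonneg ht')]
    exact ((h x).2.2.2.1 t ht').2.trans ht.2

theorem convex_tau_phi_region :
    Convex ℝ {p : ℝ × ℝ | ∃ δ : ℝ → ℝ, IsLSL δ ∧ p = (tauLSL δ, phiLSL δ)} := by
  rintro _ ⟨δ, hδ, rfl⟩ _ ⟨ε, hε, rfl⟩ a b ha hb hab
  have hμ := hδ.convex_combination hε ha hb hab
  have hφ := phiLSL_convex_combination hδ hε hab
  have hτ := tauLSL_convex_combination_le hδ hε ha hb hab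
  set μ : ℝ → ℝ := fun t => a * δ t + b * ε t
  obtain ⟨c, hc, hcφ⟩ : ∃ c ∈ Icc (0:ℝ) 1, 1 - c ^ 2 = phiLSL μ := by
    obtain ⟨h0, h1⟩ := hμ.phiLSL_mem_Icc
    refine ⟨√(1 - phiLSL μ), ⟨Real.sqrt_nonneg _, Real.sqrt_le_one.2 (by linarith)⟩, ?_⟩
    rw [Real.sq_sqrt (by linarith)]
    ring
  have hν := isLSL_sq_div_max hc
  have hντ := (tauLSL_sq_div_max hc).trans hcφ
  have hνφ := (phiLSL_sq_div_max hc).trans hcφ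
  set ν : ℝ → ℝ := fun t => t ^ 2 / max c t
  have hle : a * tauLSL δ + b * tauLSL ε ≤ phiLSL μ := by
    rw [hφ]
    exact add_le_add (mul_le_mul_of_nonneg_left hδ.tauLSL_le_phiLSL ha)
      (mul_le_mul_of_nonneg_left hε.tauLSL_le_phiLSL hb)
  have hpath : ∀ s : Icc (0:ℝ) 1, IsLSL (fun t => (1 - (s:ℝ)) * μ t + (s:ℝ) * ν t) := fun s =>
    hμ.convex_combination hν (by linarith [s.2.2]) s.2.1 (by ring)
  have hcont := continuous_tauLSL hpath fun t => by fun_prop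
  obtain ⟨s, hs⟩ : a * tauLSL δ + b * tauLSL ε ∈
      range fun s : Icc (0:ℝ) 1 => tauLSL (fun t => (1 - (s:ℝ)) * μ t + (s:ℝ) * ν t) := by
    refine mem_range_of_exists_le_of_exists_ge hcont ⟨0, ?_⟩ ⟨1, ?_⟩
    · simpa using hτ
    · simpa [hντ] using hle
  refine ⟨_, hpath s, ?_⟩
  rw [phiLSL_convex_combination hμ hν (by ring), hνφ]
  simp only at hs
  rw [hs, hφ]
  simp only [Prod.smul_mk, Prod.mk_add_mk, smul_eq_mul, Prod.mk.injEq, true_and]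
  ring

theorem isClosed_setOf_isLSL : IsClosed {δ : ℝ → ℝ | IsLSL δ} := by
  simp only [IsLSL, MonotoneOn, AntitoneOn, lipschitzOnWith_iff_dist_le_mul, ofPred_and,
    ofPred_forall]
  refine .inter ?_ <| .inter ?_ <| .inter ?_ <| .inter ?_ <| .inter ?_ ?_
  · exact isClosed_iInter fun s => isClosed_iInter fun _ => isClosed_iInter fun t =>
      isClosed_iInter fun _ => isClosed_iInter fun _ => isClosed_le (by fun_prop) (by fun_prop)
  · exact isClosed_iInter fun s => isClosed_iInter fun _ => isClosed_iInter fun t =>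
      isClosed_iInter fun _ => isClosed_le (by fun_prop) (by fun_prop)
  · exact isClosed_eq (by fun_prop) (by fun_prop)
  · exact isClosed_iInter fun s => isClosed_iInter fun _ =>
      (isClosed_le (by fun_prop) (by fun_prop)).inter (isClosed_le (by fun_prop) (by fun_prop))
  · exact isClosed_iInter fun s => isClosed_iInter fun _ => isClosed_iInter fun t =>
      isClosed_iInter fun _ => isClosed_iInter fun _ => isClosed_le (by fun_prop) (by fun_prop)
  · exact isClosed_iInter fun s => isClosed_iInter fun _ => isClosed_iInter fun t =>
      isClosed_iInter fun _ => isClosed_iInter fun _ => isClosed_le (by fun_prop) (by fun_prop)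

theorem IsLSL.congr {δ ε : ℝ → ℝ} (h : IsLSL δ) (he : EqOn ε δ (Icc 0 1)) : IsLSL ε := by
  obtain ⟨-, -, h1, hb, hm, ha⟩ := h
  refine IsLSL.mk_of_ratio (by rw [he (by simp), h1]) (fun t ht => he ht ▸ hb t ht)
    (hm.congr fun t ht => ?_) (ha.congr fun t ht => ?_) <;>
  simp only [he (Ioc_subset_Icc_self ht)]

theorem isCompact_setOf_isLSL_IccExtend :
    IsCompact {f : C(Icc (0:ℝ) 1, ℝ) | IsLSL (IccExtend zero_le_one f)} := by
  have hlip : ∀ g : Icc (0:ℝ) 1 → ℝ, IsLSL (IccExtend zero_le_one g) → LipschitzWith 2 g := by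
    intro g hg
    refine LipschitzWith.of_dist_le_mul fun x y => ?_
    simpa [Subtype.dist_eq] using hg.2.1.dist_le_mul x x.2 y y.2
  refine ArzelaAscoli.isCompact_of_equicontinuous _ ?_ ?_
  · have himage : ContinuousMap.toFun ''
          {f : C(Icc (0:ℝ) 1, ℝ) | IsLSL (IccExtend zero_le_one f)} =
        {g : Icc (0:ℝ) 1 → ℝ | IsLSL (IccExtend zero_le_one g)} := by
      ext g
      constructor
      · rintro ⟨f, hf, rfl⟩
        exact hf
      · intro hg
        exact ⟨⟨g, (hlip g hg).continuous⟩, hg, rfl⟩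
    rw [himage]
    refine (isCompact_univ_pi fun _ : Icc (0:ℝ) 1 =>
      isCompact_Icc (a := (0:ℝ)) (b := 1)).of_isClosed_subset
        (isClosed_setOf_isLSL.preimage (f := fun g : Icc (0:ℝ) 1 → ℝ =>
      IccExtend zero_le_one g) ?_) fun g hg x _ => ?_
    · exact continuous_pi fun t => continuous_apply (projIcc 0 1 zero_le_one t)
    · have h0 := hg.nonneg x.2
      have h1 := (hg.2.2.2.1 x x.2).2
      rw [IccExtend_val] at h0 h1
      exact ⟨h0, h1.trans x.2.2⟩
  · exact (LipschitzWith.uniformEquicontinuous _ 2 fun f => hlip _ f.2).equicontinuous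

theorem isCompact_tau_phi_region :
    IsCompact {p : ℝ × ℝ | ∃ δ : ℝ → ℝ, IsLSL δ ∧ p = (tauLSL δ, phiLSL δ)} := by
  set K := {f : C(Icc (0:ℝ) 1, ℝ) | IsLSL (IccExtend zero_le_one f)}
  have : CompactSpace K := isCompact_iff_compactSpace.1 isCompact_setOf_isLSL_IccExtend
  have hev : ∀ t : ℝ, Continuous fun f : K => IccExtend zero_le_one (f : C(Icc (0:ℝ) 1, ℝ)) t :=
    fun t => (continuous_eval_const (projIcc 0 1 zero_le_one t)).comp continuous_subtype_val
  have hcont := (continuous_tauLSL (fun f : K => f.2) hev).prodMk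
    (continuous_phiLSL (fun f : K => f.2) hev)
  convert isCompact_range hcont using 1
  ext p
  constructor
  · rintro ⟨δ, hδ, rfl⟩
    have heq : EqOn (IccExtend zero_le_one ((Icc (0:ℝ) 1).domRestrict δ)) δ (Icc 0 1) :=
      fun t ht => IccExtend_of_mem _ _ ht
    have hu : uIcc (0:ℝ) 1 = Icc 0 1 := uIcc_of_le zero_le_one
    refine ⟨⟨⟨(Icc (0:ℝ) 1).domRestrict δ, hδ.continuousOn.domRestrict⟩, hδ.congr heq⟩, ?_⟩
    refine Prod.ext ?_ ?_
    · change tauLSL (IccExtend zero_le_one ((Icc (0:ℝ) 1).domRestrict δ)) = tauLSL δ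
      unfold tauLSL
      rw [intervalIntegral.integral_congr (g := fun t => δ t ^ 2 / t)
        fun t ht => by simp only [heq (hu ▸ ht)]]
    · change phiLSL (IccExtend zero_le_one ((Icc (0:ℝ) 1).domRestrict δ)) = phiLSL δ
      unfold phiLSL
      rw [intervalIntegral.integral_congr fun t ht => heq (hu ▸ ht)]
  · rintro ⟨f, rfl⟩
    exact ⟨_, f.2, rfl⟩

/-- The τ-φ region for lower semilinear copulas is convex and compact. -/
theorem tau_phi_region_convex_compact :
    Convex ℝ {p : ℝ × ℝ | ∃ δ : ℝ → ℝ, IsLSL δ ∧ p = (tauLSL δ, phiLSL δ)} ∧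
    IsCompact {p : ℝ × ℝ | ∃ δ : ℝ → ℝ, IsLSL δ ∧ p = (tauLSL δ, phiLSL δ)} :=
  ⟨convex_tau_phi_region, isCompact_tau_phi_region⟩
end
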